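/- Let X = (x₁,…,xₙ) be a vector configuration of nonzero vectors spanning ℝ^d, d ≥ 2, and suppose the zonotope Z(X) tiles ℝ^d face-to-face by translations. Let L ⊆ ℤⁿ be the lattice generated by the cocircuits of X. Then L is a zonotopal lattice of rank d, and there exists a weighted inner product (·,·) on ℝⁿ such that DV(L, (·,·)) is affinely equivalent to Z(X), i.e., there is a linear bijection T : span_ℝ(L) → ℝ^d with T(DV(L, (·,·))) = Z(X). -/

import Mathlib

/-- The support of an integer vector: the set of its nonzero coordinates. -/
def supp {n : ℕ} (v : Fin n → ℤ) : Set (Fin n) := {i | v i ≠ 0}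

/-- `v` is an elementary vector of the lattice `L ⊆ ℤⁿ`: it is a nonzero lattice
vector with entries in `{-1,0,+1}` whose support is minimal among supports of
nonzero lattice vectors. -/
def IsElementary {n : ℕ} (L : AddSubgroup (Fin n → ℤ)) (v : Fin n → ℤ) : Prop :=
  v ∈ L ∧ v ≠ 0 ∧ (∀ i, v i = -1 ∨ v i = 0 ∨ v i = 1) ∧
    ∀ u ∈ L, u ≠ 0 → ¬ (supp u ⊂ supp v)

/-- A lattice `L ⊆ ℤⁿ` is zonotopal if every nonzero lattice vector's support
contains the support of some elementary vector. -/
def IsZonotopal {n : ℕ} (L : AddSubgroup (Fin n → ℤ)) : Prop :=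
  ∀ v ∈ L, v ≠ 0 → ∃ u, IsElementary L u ∧ supp u ⊆ supp v

/-- The weighted inner product on `ℝⁿ` with weights `lam`. -/
def wip {n : ℕ} (lam : Fin n → ℝ) (x y : Fin n → ℝ) : ℝ := ∑ i, lam i * x i * y i

/-- Coordinatewise cast of an integer vector to a real vector. -/
def icast {n : ℕ} (v : Fin n → ℤ) : Fin n → ℝ := fun i => (v i : ℝ)

/-- The real span `F` of a lattice `L ⊆ ℤⁿ`. -/
def latticeSpan {n : ℕ} (L : AddSubgroup (Fin n → ℤ)) : Submodule ℝ (Fin n → ℝ) :=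
  Submodule.span ℝ (icast '' (L : Set (Fin n → ℤ)))

/-- The Dirichlet-Voronoi polytope of a lattice `L ⊆ ℤⁿ` with respect to the
weighted inner product with weights `lam`. -/
def DV {n : ℕ} (L : AddSubgroup (Fin n → ℤ)) (lam : Fin n → ℝ) : Set (Fin n → ℝ) :=
  {x | x ∈ latticeSpan L ∧
    ∀ v ∈ L, wip lam x (icast v) ≤ wip lam (icast v) (icast v) / 2}

/-- `v` is a strict Voronoi vector of `L` with respect to the weighted inner
product with weights `lam`: `±v` are the unique shortest vectors of `v + 2L`. -/
def IsStrictVoronoi {n : ℕ} (L : AddSubgroup (Fin n → ℤ)) (lam : Fin n → ℝ)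
    (v : Fin n → ℤ) : Prop :=
  v ∈ L ∧ v ≠ 0 ∧ ∀ w ∈ L, v + 2 • w ≠ v → v + 2 • w ≠ -v →
    wip lam (icast v) (icast v) <
      wip lam (icast (v + 2 • w)) (icast (v + 2 • w))

/-- Two integer vectors are conformal if their entries never have opposite signs. -/
def IsConformal {n : ℕ} (v w : Fin n → ℤ) : Prop := ∀ i, 0 ≤ v i * w i

/-- The sign of a real number, as an integer in `{-1,0,+1}`. -/
noncomputable def sgnR (t : ℝ) : ℤ := if 0 < t then 1 else if t < 0 then -1 else 0

/-- A covector of the vector configuration `X`: the sign vector of the values of a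
linear functional on the configuration. -/
def IsCovector {n d : ℕ} (X : Fin n → Fin d → ℝ) (s : Fin n → ℤ) : Prop :=
  ∃ f : (Fin d → ℝ) →ₗ[ℝ] ℝ, ∀ i, s i = sgnR (f (X i))

/-- A cocircuit of the vector configuration `X`: a nonzero covector of minimal support. -/
def IsCocircuit {n d : ℕ} (X : Fin n → Fin d → ℝ) (s : Fin n → ℤ) : Prop :=
  IsCovector X s ∧ s ≠ 0 ∧ ∀ t, IsCovector X t → t ≠ 0 → ¬ (supp t ⊂ supp s)

/-- The lattice in `ℤⁿ` generated by the cocircuits of `X`. -/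
def cocircuitLattice {n d : ℕ} (X : Fin n → Fin d → ℝ) : AddSubgroup (Fin n → ℤ) :=
  AddSubgroup.closure {s | IsCocircuit X s}

/-- A linear subspace of `ℝ^d` spanned by a subset of the configuration `X`. -/
def SpannedSubspace {n d : ℕ} (X : Fin n → Fin d → ℝ)
    (W : Submodule ℝ (Fin d → ℝ)) : Prop :=
  ∃ S : Set (Fin n), W = Submodule.span ℝ (X '' S)

/-- McMullen's condition (II): every `(d-2)`-dimensional subspace spanned by vectors
of `X` is contained in exactly `2` or `3` hyperplanes spanned by vectors of `X`. -/
def ConditionII {n d : ℕ} (X : Fin n → Fin d → ℝ) : Prop :=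
  ∀ W : Submodule ℝ (Fin d → ℝ), SpannedSubspace X W → Module.finrank ℝ W = d - 2 →
    {H : Submodule ℝ (Fin d → ℝ) |
        SpannedSubspace X H ∧ Module.finrank ℝ H = d - 1 ∧ W ≤ H}.ncard = 2 ∨
    {H : Submodule ℝ (Fin d → ℝ) |
        SpannedSubspace X H ∧ Module.finrank ℝ H = d - 1 ∧ W ≤ H}.ncard = 3

/-- The zonotope generated by the vector configuration `X`, i.e. the Minkowski sum
of the segments `conv{xᵢ, -xᵢ}`. -/
def zonotope {n d : ℕ} (X : Fin n → Fin d → ℝ) : Set (Fin d → ℝ) :=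
  {z | ∃ c : Fin n → ℝ, (∀ i, |c i| ≤ 1) ∧ z = ∑ i, c i • X i}

/-- `P` tiles `ℝ^d` face-to-face by translations: some family of translates of `P`
covers `ℝ^d`, and any two distinct translates intersect in a common (possibly empty)
exposed face. -/
def TilesFaceToFace {d : ℕ} (P : Set (Fin d → ℝ)) : Prop :=
  ∃ T : Set (Fin d → ℝ),
    (∀ x, ∃ t ∈ T, x ∈ (t + ·) '' P) ∧
    ∀ s ∈ T, ∀ t ∈ T, s ≠ t →
      IsExposed ℝ ((s + ·) '' P) (((s + ·) '' P) ∩ ((t + ·) '' P)) ∧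
      IsExposed ℝ ((t + ·) '' P) (((s + ·) '' P) ∩ ((t + ·) '' P))


/-! ### Zonotopes and tilings -/

/-- Support function of the zonotope. -/
noncomputable def hfun {n d : ℕ} (X : Fin n → Fin d → ℝ) (l : Module.Dual ℝ (Fin d → ℝ)) : ℝ :=
  ∑ i, |l (X i)|

theorem zon_le {n d : ℕ} (X : Fin n → Fin d → ℝ) (l : Module.Dual ℝ (Fin d → ℝ))
    {z : Fin d → ℝ} (hz : z ∈ zonotope X) : l z ≤ hfun X l := by
  obtain ⟨c, hc, rfl⟩ := hz
  rw [map_sum, hfun]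
  refine Finset.sum_le_sum fun i _ => ?_
  rw [map_smul, smul_eq_mul]
  calc c i * l (X i) ≤ |c i * l (X i)| := le_abs_self _
    _ = |c i| * |l (X i)| := abs_mul _ _
    _ ≤ 1 * |l (X i)| := by gcongr; exact hc i
    _ = _ := one_mul _

theorem zon_neg {n d : ℕ} {X : Fin n → Fin d → ℝ} {z : Fin d → ℝ} (hz : z ∈ zonotope X) :
    -z ∈ zonotope X := by
  obtain ⟨c, hc, rfl⟩ := hz
  refine ⟨fun i => - c i, fun i => by simpa using hc i, ?_⟩
  simp

theorem zon_image {n d : ℕ} (X : Fin n → Fin d → ℝ) :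
    zonotope X = (Fintype.linearCombination ℝ X) '' (Set.pi Set.univ fun _ => Set.Icc (-1) 1) := by
  ext z
  constructor
  · rintro ⟨c, hc, rfl⟩
    exact ⟨c, fun i _ => abs_le.1 (hc i), by simp [Fintype.linearCombination_apply]⟩
  · rintro ⟨c, hc, rfl⟩
    exact ⟨c, fun i => abs_le.2 (hc i trivial), by simp [Fintype.linearCombination_apply]⟩

theorem zon_compact {n d : ℕ} (X : Fin n → Fin d → ℝ) : IsCompact (zonotope X) := by
  rw [zon_image]
  refine IsCompact.image (isCompact_univ_pi fun _ => isCompact_Icc) ?_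
  exact LinearMap.continuous_of_finiteDimensional _

theorem zon_convex {n d : ℕ} (X : Fin n → Fin d → ℝ) : Convex ℝ (zonotope X) := by
  rw [zon_image]
  exact Convex.linear_image (convex_pi fun _ _ => convex_Icc _ _) _

/-- Hahn-Banach: the zonotope is determined by its support function. -/
theorem zon_of_le {n d : ℕ} (X : Fin n → Fin d → ℝ) (z : Fin d → ℝ)
    (h : ∀ l : Module.Dual ℝ (Fin d → ℝ), l z ≤ hfun X l) : z ∈ zonotope X := by
  by_contra hz
  obtain ⟨f, u, hf, hu⟩ := geometric_hahn_banach_closed_point (zon_convex X)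
    (zon_compact X).isClosed hz
  have h1 := h f.toLinearMap
  have h2 : (∑ i, (if 0 ≤ f (X i) then (1:ℝ) else -1) • X i) ∈ zonotope X := by
    refine ⟨_, fun i => ?_, rfl⟩
    split_ifs <;> simp
  have h3 := hf _ h2
  have h4 : f (∑ i, (if 0 ≤ f (X i) then (1:ℝ) else -1) • X i) = hfun X f.toLinearMap := by
    rw [map_sum, hfun]
    refine Finset.sum_congr rfl fun i _ => ?_
    rw [map_smul, smul_eq_mul]
    split_ifs with hh
    · simp [abs_of_nonneg hh]
    · simp [abs_of_neg (not_le.1 hh)]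
  rw [h4] at h3
  have : f.toLinearMap z = f z := rfl
  linarith

theorem transl_zero {d : ℕ} {A : Set (Fin d → ℝ)} (hA : Bornology.IsBounded A) (hne : A.Nonempty)
    (v : Fin d → ℝ) (h : ∀ z ∈ A, z + v ∈ A) : v = 0 := by
  obtain ⟨a, ha⟩ := hne
  have h1 : ∀ k : ℕ, a + (k : ℝ) • v ∈ A := by
    intro k
    induction k with
    | zero => simpa using ha
    | succ k ih =>
      have := h _ ih
      rw [add_assoc] at this
      convert this using 2
      push_cast
      module
  obtain ⟨C, hC⟩ := hA.exists_norm_le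
  by_contra hv
  have hv' : 0 < ‖v‖ := norm_pos_iff.2 hv
  obtain ⟨k, hk⟩ := exists_nat_gt ((C + ‖a‖) / ‖v‖)
  rw [div_lt_iff₀ hv'] at hk
  have h2 := hC _ (h1 k)
  have h3 : ‖(k:ℝ) • v‖ ≤ ‖a + (k:ℝ) • v‖ + ‖a‖ := by
    calc ‖(k:ℝ) • v‖ = ‖(a + (k:ℝ) • v) - a‖ := by congr 1; abel
      _ ≤ _ := norm_sub_le _ _
  rw [norm_smul] at h3
  simp at h3
  linarith

/-- A convenient reformulation of the tiling hypothesis. -/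
def Tl {n d : ℕ} (X : Fin n → Fin d → ℝ) (T : Set (Fin d → ℝ)) : Prop :=
  (∀ x, ∃ t ∈ T, x - t ∈ zonotope X) ∧
  ∀ s ∈ T, ∀ t ∈ T, s ≠ t → ∀ p, p - s ∈ zonotope X → p - t ∈ zonotope X →
    ∃ l : Module.Dual ℝ (Fin d → ℝ), ∀ y, y - s ∈ zonotope X →
      (y - t ∈ zonotope X ↔ ∀ z ∈ zonotope X, l z ≤ l (y - s))

theorem mem_tr {d : ℕ} (P : Set (Fin d → ℝ)) (s y : Fin d → ℝ) :
    y ∈ (s + ·) '' P ↔ y - s ∈ P := by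
  constructor
  · rintro ⟨z, hz, rfl⟩
    simpa using hz
  · intro h
    exact ⟨_, h, by simp⟩

theorem tl_of_tiles {n d : ℕ} (X : Fin n → Fin d → ℝ) (h : TilesFaceToFace (zonotope X)) :
    ∃ T, Tl X T := by
  obtain ⟨T, h1, h2⟩ := h
  refine ⟨T, fun x => ?_, fun s hs t ht hst p hps hpt => ?_⟩
  · obtain ⟨t, ht, hx⟩ := h1 x
    exact ⟨t, ht, (mem_tr _ _ _).1 hx⟩
  · obtain ⟨l, hl⟩ := (h2 s hs t ht hst).1 ⟨p, (mem_tr _ _ _).2 hps, (mem_tr _ _ _).2 hpt⟩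
    refine ⟨l.toLinearMap, fun y hy => ?_⟩
    have h3 := Set.ext_iff.1 hl y
    simp only [Set.mem_inter_iff, mem_tr, Set.mem_ofPred_eq] at h3
    constructor
    · intro hyt z hz
      have := (h3.1 ⟨hy, hyt⟩).2 (s + z) (by simpa using hz)
      simp only [map_add] at this
      simp only [ContinuousLinearMap.coe_coe, map_sub]
      linarith
    · intro hh
      refine (h3.2 ⟨hy, fun w hw => ?_⟩).2
      have := hh _ hw
      simp only [ContinuousLinearMap.coe_coe, map_sub] at this
      linarith

/-- If a tile is contained in another tile then they agree. -/
theorem tile_sub {n d : ℕ} {X : Fin n → Fin d → ℝ} {s t : Fin d → ℝ}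
    (h : ∀ y, y - s ∈ zonotope X → y - t ∈ zonotope X) : s = t := by
  have h0 : (zonotope X).Nonempty := ⟨0, fun _ => 0, by simp, by simp⟩
  have := transl_zero (zon_compact X).isBounded h0 (s - t) (fun z hz => by
    have := h (z + s) (by simpa using hz)
    convert this using 1
    abel)
  exact sub_eq_zero.1 this

/-- Two distinct tiles do not overlap. -/
theorem tile_int {n d : ℕ} {X : Fin n → Fin d → ℝ} {T : Set (Fin d → ℝ)} (hT : Tl X T)
    {s w : Fin d → ℝ} (hs : s ∈ T) (ht : s + (2:ℝ) • w ∈ T) (hwZ : w ∈ zonotope X)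
    (hw : ∀ l : Module.Dual ℝ (Fin d → ℝ), (∀ z ∈ zonotope X, l z ≤ l w) → l = 0) : w = 0 := by
  by_contra hne
  have hst : s ≠ s + (2:ℝ) • w := by
    intro h
    apply hne
    simpa using h
  have h2 : (s + w) - (s + (2:ℝ) • w) ∈ zonotope X := by
    have : (s + w) - (s + (2:ℝ) • w) = - w := by module
    rw [this]
    exact zon_neg hwZ
  obtain ⟨l, hl⟩ := hT.2 s hs _ ht hst (s + w) (by simpa using hwZ) h2
  have h3 := (hl (s + w) (by simpa using hwZ)).1 h2
  simp only [add_sub_cancel_left] at h3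
  have h0 := hw l h3
  apply hst
  refine tile_sub (X := X) fun y hy => (hl y hy).2 ?_
  simp [h0]

/-- Tiles are separated. -/
theorem tile_sep {n d : ℕ} {X : Fin n → Fin d → ℝ} {T : Set (Fin d → ℝ)} (hT : Tl X T)
    {s t : Fin d → ℝ} (hs : s ∈ T) (ht : t ∈ T) (h : s - t ∈ zonotope X) : s = t := by
  by_contra hst
  have h0 : (0 : Fin d → ℝ) ∈ zonotope X := ⟨fun _ => 0, by simp, by simp⟩
  obtain ⟨l, hl⟩ := hT.2 s hs t ht hst s (by simpa using h0) h
  have h1 := (hl s (by simpa using h0)).1 h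
  simp only [sub_self, map_zero] at h1
  have h2 : ∀ z ∈ zonotope X, l z = 0 := fun z hz => by
    have := h1 _ (zon_neg hz)
    rw [map_neg] at this
    linarith [h1 z hz]
  apply hst
  refine tile_sub (X := X) fun y hy => (hl y hy).2 fun z hz => ?_
  rw [h2 z hz, h2 _ hy]

/-- A basis chosen from the configuration, together with its dual basis. -/
structure DP {n d : ℕ} (X : Fin n → Fin d → ℝ) where
  b : Fin d → Fin n
  f : Fin d → Module.Dual ℝ (Fin d → ℝ)
  h : ∀ r s, f r (X (b s)) = if r = s then 1 else 0

theorem DP.inj {n d : ℕ} {X : Fin n → Fin d → ℝ} (D : DP X) : Function.Injective D.b := by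
  intro r s h
  by_contra hrs
  have h1 := D.h r s
  have h2 := D.h r r
  rw [h] at h2
  rw [if_neg hrs] at h1
  rw [if_pos rfl] at h2
  linarith

theorem DP.linInd {n d : ℕ} {X : Fin n → Fin d → ℝ} (D : DP X) :
    LinearIndependent ℝ (fun r => X (D.b r)) := by
  rw [Fintype.linearIndependent_iff]
  intro g hg r
  have := congrArg (D.f r) hg
  simpa [map_sum, D.h] using this

theorem DP.vec {n d : ℕ} {X : Fin n → Fin d → ℝ} (D : DP X) (v : Fin d → ℝ) :
    v = ∑ r, D.f r v • X (D.b r) := by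
  have hs := D.linInd.span_eq_top_of_card_eq_finrank' (by simp)
  have hv : v ∈ Submodule.span ℝ (Set.range fun r => X (D.b r)) := by rw [hs]; trivial
  obtain ⟨c, rfl⟩ := (Submodule.mem_span_range_iff_exists_fun ℝ).1 hv
  refine Finset.sum_congr rfl fun r _ => ?_
  congr 1
  simp [map_sum, D.h]

theorem DP.dual {n d : ℕ} {X : Fin n → Fin d → ℝ} (D : DP X) (l : Module.Dual ℝ (Fin d → ℝ)) :
    l = ∑ r, l (X (D.b r)) • D.f r := by
  refine LinearMap.ext fun v => ?_
  conv_lhs => rw [D.vec v]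
  simp [map_sum, mul_comm]

theorem DP.exists {n d : ℕ} (X : Fin n → Fin d → ℝ)
    (hX : Submodule.span ℝ (Set.range X) = ⊤) : Nonempty (DP X) := by
  have key := Submodule.exists_fun_fin_finrank_span_eq ℝ (Set.range X)
  rw [hX, finrank_top, Module.finrank_fin_fun] at key
  obtain ⟨g, hg, hs, hi⟩ := key
  choose b hb using hg
  let B := Module.Basis.mk hi hs.ge
  refine ⟨⟨b, fun r => B.coord r, fun r s => ?_⟩⟩
  have : X (b s) = B s := by rw [hb]; simp [B]
  rw [this]
  simp [Finsupp.single_apply, eq_comm]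

theorem DP.zon {n d : ℕ} {X : Fin n → Fin d → ℝ} (D : DP X) (z : Fin d → ℝ)
    (hz : ∀ r, |D.f r z| ≤ 1) : z ∈ zonotope X := by
  refine zon_of_le X z fun l => ?_
  calc l z = ∑ r, D.f r z * l (X (D.b r)) := by
        conv_lhs => rw [D.vec z]
        simp [map_sum]
    _ ≤ ∑ r, |l (X (D.b r))| := by
        refine Finset.sum_le_sum fun r _ => ?_
        calc _ ≤ |D.f r z * l (X (D.b r))| := le_abs_self _
          _ = |D.f r z| * |l (X (D.b r))| := abs_mul _ _
          _ ≤ 1 * |l (X (D.b r))| := by gcongr; exact hz r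
          _ = _ := one_mul _
    _ = ∑ i ∈ Finset.univ.map ⟨D.b, D.inj⟩, |l (X i)| := by simp
    _ ≤ hfun X l := Finset.sum_le_sum_of_subset_of_nonneg (Finset.subset_univ _)
        fun _ _ _ => abs_nonneg _

theorem DP.nhdZ {n d : ℕ} {X : Fin n → Fin d → ℝ} (D : DP X) : zonotope X ∈ nhds (0 : Fin d → ℝ) := by
  have h1 : ∀ r, ∀ᶠ z in nhds (0 : Fin d → ℝ), |D.f r z| < 1 := by
    intro r
    have hc : Continuous fun z => |D.f r z| :=
      (LinearMap.continuous_of_finiteDimensional (D.f r)).abs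
    have := hc.tendsto 0
    simp only [map_zero, abs_zero] at this
    exact this.eventually (gt_mem_nhds one_pos)
  filter_upwards [Filter.eventually_all.2 h1] with z hz
  exact D.zon z fun r => (hz r).le

/-- Locally near a limit of points, some tile is used infinitely often. -/
theorem tile_lim {n d : ℕ} {X : Fin n → Fin d → ℝ} (D : DP X) {T : Set (Fin d → ℝ)} (hT : Tl X T)
    (p v : Fin d → ℝ) : ∃ t ∈ T, p - t ∈ zonotope X ∧ ∃ ε : ℝ, 0 < ε ∧
      p + ε • v - t ∈ zonotope X := by
  choose t ht htz using fun k : ℕ => hT.1 (p + (1 / ((k:ℝ) + 1)) • v)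
  obtain ⟨z, hz, φ, hφ, hlim⟩ := (zon_compact X).tendsto_subseq htz
  have h1 : Filter.Tendsto (fun k : ℕ => p + (1 / ((k:ℝ) + 1)) • v) Filter.atTop (nhds p) := by
    have : Filter.Tendsto (fun k : ℕ => p + (1 / ((k:ℝ) + 1)) • v) Filter.atTop
        (nhds (p + (0:ℝ) • v)) :=
      tendsto_const_nhds.add (tendsto_one_div_add_atTop_nhds_zero_nat.smul_const v)
    simpa using this
  have h2 : Filter.Tendsto (fun k => t (φ k)) Filter.atTop (nhds (p - z)) := by
    have := (h1.comp hφ.tendsto_atTop).sub hlim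
    refine this.congr fun k => ?_
    simp
  have h3 : Filter.Tendsto (fun q : ℕ × ℕ => t (φ q.1) - t (φ q.2))
      (Filter.atTop ×ˢ Filter.atTop) (nhds 0) := by
    have := (h2.comp Filter.tendsto_fst).sub (h2.comp (Filter.tendsto_snd (f := Filter.atTop)))
    simpa using this
  have h4 := h3.eventually D.nhdZ
  rw [Filter.prod_atTop_atTop_eq, Filter.eventually_atTop] at h4
  obtain ⟨⟨N, M⟩, hN⟩ := h4
  set K := max N M with hK
  have h5 : ∀ k ≥ K, t (φ k) = t (φ K) := fun k hk =>
    tile_sep hT (ht _) (ht _) (hN (k, K) ⟨(le_max_left _ _).trans hk, le_max_right _ _⟩)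
  have h6 : t (φ K) = p - z := by
    refine tendsto_nhds_unique (tendsto_const_nhds.congr' ?_) h2
    filter_upwards [Filter.eventually_ge_atTop K] with k hk
    exact (h5 k hk).symm
  refine ⟨t (φ K), ht _, ?_, 1 / ((φ K : ℝ) + 1), by positivity, htz _⟩
  rw [h6]
  simpa using hz

/-- Center of the face exposed by `g`. -/
noncomputable def ctr {n d : ℕ} (X : Fin n → Fin d → ℝ) (g : Module.Dual ℝ (Fin d → ℝ)) : Fin d → ℝ :=
  ∑ i, (SignType.sign (g (X i)) : ℝ) • X i

theorem abs_sign_le (x : ℝ) : |((SignType.sign x : SignType) : ℝ)| ≤ 1 := by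
  rcases lt_trichotomy x 0 with h | h | h <;> simp [h]

theorem ctr_mem {n d : ℕ} (X : Fin n → Fin d → ℝ) (g : Module.Dual ℝ (Fin d → ℝ)) :
    ctr X g ∈ zonotope X :=
  ⟨_, fun _ => abs_sign_le _, rfl⟩

theorem ctr_val {n d : ℕ} (X : Fin n → Fin d → ℝ) (g : Module.Dual ℝ (Fin d → ℝ)) :
    g (ctr X g) = hfun X g := by
  rw [ctr, hfun, map_sum]
  refine Finset.sum_congr rfl fun i _ => ?_
  rw [map_smul, smul_eq_mul, sign_mul_self]

/-- If `l` attains its maximum over the zonotope at `∑ cᵢxᵢ`, then `l` vanishes on `xᵢ` whenever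
`|cᵢ| < 1`. -/
theorem max_vanish {n d : ℕ} (X : Fin n → Fin d → ℝ) (l : Module.Dual ℝ (Fin d → ℝ))
    (c : Fin n → ℝ) (hc : ∀ i, |c i| ≤ 1)
    (hm : ∀ z ∈ zonotope X, l z ≤ l (∑ i, c i • X i)) (i : Fin n) (hi : c i = 0) : l (X i) = 0 := by
  have h1 := hm _ (ctr_mem X l)
  rw [ctr_val, hfun, map_sum] at h1
  have h2 : ∀ i, l (c i • X i) ≤ |l (X i)| := fun i => by
    rw [map_smul, smul_eq_mul]
    calc c i * l (X i) ≤ |c i * l (X i)| := le_abs_self _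
      _ = |c i| * |l (X i)| := abs_mul _ _
      _ ≤ 1 * |l (X i)| := by gcongr; exact hc i
      _ = _ := one_mul _
  have h3 := (Finset.sum_eq_sum_iff_of_le (s := Finset.univ) (fun i _ => h2 i)).1
    (le_antisymm (Finset.sum_le_sum fun i _ => h2 i) h1) i (Finset.mem_univ _)
  simp only [hi, zero_smul, map_zero] at h3
  exact abs_eq_zero.1 h3.symm

/-- The face exposed by `g` is symmetric about its center. -/
theorem face_reflect {n d : ℕ} (X : Fin n → Fin d → ℝ) (g : Module.Dual ℝ (Fin d → ℝ))
    {z : Fin d → ℝ} (hz : z ∈ zonotope X) (hg : g z = hfun X g) :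
    (2:ℝ) • ctr X g - z ∈ zonotope X := by
  obtain ⟨c, hc, rfl⟩ := hz
  rw [hfun, map_sum] at hg
  have h2 : ∀ i, g (c i • X i) ≤ |g (X i)| := fun i => by
    rw [map_smul, smul_eq_mul]
    calc c i * g (X i) ≤ |c i * g (X i)| := le_abs_self _
      _ = |c i| * |g (X i)| := abs_mul _ _
      _ ≤ 1 * |g (X i)| := by gcongr; exact hc i
      _ = _ := one_mul _
  have h3 := (Finset.sum_eq_sum_iff_of_le (s := Finset.univ) (fun i _ => h2 i)).1 hg
  refine ⟨fun i => 2 * (SignType.sign (g (X i)) : ℝ) - c i, fun i => ?_, ?_⟩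
  · have h4 := h3 i (Finset.mem_univ _)
    rw [map_smul, smul_eq_mul] at h4
    rcases lt_trichotomy (g (X i)) 0 with h | h | h
    · have : c i = -1 := by
        rw [abs_of_neg h] at h4
        have : (c i + 1) * g (X i) = 0 := by linarith
        rcases mul_eq_zero.1 this with h' | h' <;> linarith
      simp [h, this]
      norm_num
    · simpa [h] using hc i
    · have : c i = 1 := by
        rw [abs_of_pos h] at h4
        have : (c i - 1) * g (X i) = 0 := by linarith
        rcases mul_eq_zero.1 this with h' | h' <;> linarith
      simp [h, this]
      norm_num
  · rw [ctr, Finset.smul_sum, ← Finset.sum_sub_distrib]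
    refine Finset.sum_congr rfl fun i _ => ?_
    module

/-- The neighbour of a tile across a facet. -/
theorem facet_nb {n d : ℕ} {X : Fin n → Fin d → ℝ} (D : DP X) {T : Set (Fin d → ℝ)} (hT : Tl X T)
    (g : Module.Dual ℝ (Fin d → ℝ)) (hg0 : g ≠ 0)
    (hg : ∀ l : Module.Dual ℝ (Fin d → ℝ), (∀ j, g (X j) = 0 → l (X j) = 0) → ∃ c : ℝ, l = c • g)
    {t : Fin d → ℝ} (ht : t ∈ T) : t + (2:ℝ) • ctr X g ∈ T := by
  obtain ⟨t', ht', hp, ε, hε, hpε⟩ := tile_lim D hT (t + ctr X g) (ctr X g)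
  have hpos : 0 < hfun X g := by
    refine lt_of_le_of_ne (Finset.sum_nonneg fun _ _ => abs_nonneg _) fun h0 => hg0 ?_
    have h1 := (Finset.sum_eq_zero_iff_of_nonneg (fun i _ => abs_nonneg (g (X i)))).1 h0.symm
    rw [D.dual g]
    refine Finset.sum_eq_zero fun r _ => ?_
    rw [abs_eq_zero.1 (h1 _ (Finset.mem_univ _)), zero_smul]
  have hgt : g t < g t' := by
    have := zon_le X g hpε
    simp only [map_sub, map_add, map_smul, ctr_val, smul_eq_mul] at this
    nlinarith
  have hne : t ≠ t' := fun h => by rw [h] at hgt; exact lt_irrefl _ hgt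
  have hct : t + ctr X g - t ∈ zonotope X := by simpa using ctr_mem X g
  obtain ⟨l, hl⟩ := hT.2 t ht t' ht' hne _ hct hp
  obtain ⟨l', hl'⟩ := hT.2 t' ht' t ht hne.symm _ hp hct
  -- `l` is a positive multiple of `g`
  have hl1 := (hl _ hct).1 hp
  simp only [add_sub_cancel_left] at hl1
  obtain ⟨c, hc⟩ := hg l fun j hj => max_vanish X l _ (fun i => abs_sign_le (g (X i))) hl1 j (by simp [hj])
  have hc0 : 0 < c := by
    have h1 := hl1 _ (zon_neg (ctr_mem X g))
    rw [hc] at h1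
    simp only [map_neg, LinearMap.smul_apply, ctr_val, smul_eq_mul] at h1
    have h2 : 0 ≤ c := by nlinarith
    refine lt_of_le_of_ne h2 fun h0 => hne ?_
    refine tile_sub (X := X) fun y hy => (hl y hy).2 ?_
    simp [hc, ← h0]
  -- description of the intersection
  have hI : ∀ y, y - t ∈ zonotope X → (y - t' ∈ zonotope X ↔ g (y - t) = hfun X g) := by
    intro y hy
    rw [hl y hy]
    constructor
    · intro h
      have := h _ (ctr_mem X g)
      rw [hc] at this
      simp only [LinearMap.smul_apply, ctr_val, smul_eq_mul] at this
      exact le_antisymm (zon_le X g hy) (le_of_mul_le_mul_left this hc0)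
    · intro h z hz
      rw [hc]
      simp only [LinearMap.smul_apply, smul_eq_mul]
      rw [h]
      exact mul_le_mul_of_nonneg_left (zon_le X g hz) hc0.le
  -- `l'` is a multiple of `g`
  have hvan : ∀ j, g (X j) = 0 → l' (X j) = 0 := by
    intro j hj
    have hsh : ∀ e : ℝ, |e| ≤ 1 → ctr X g + e • X j ∈ zonotope X := by
      intro e he
      refine ⟨fun i => if i = j then e else (SignType.sign (g (X i)) : ℝ), fun i => ?_, ?_⟩
      · simp only
        split_ifs
        · exact he
        · exact abs_sign_le _
      · rw [ctr, ← Finset.add_sum_erase _ _ (Finset.mem_univ j),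
          ← Finset.add_sum_erase _ _ (Finset.mem_univ j)]
        simp only [hj, if_true]
        have : ∑ x ∈ Finset.univ.erase j, (if x = j then e else (SignType.sign (g (X x)) : ℝ)) • X x
            = ∑ x ∈ Finset.univ.erase j, (SignType.sign (g (X x)) : ℝ) • X x := by
          refine Finset.sum_congr rfl fun x hx => ?_
          rw [if_neg (Finset.ne_of_mem_erase hx)]
        rw [this]
        simp
        abel
    have hin : ∀ e : ℝ, |e| ≤ 1 → (t + ctr X g + e • X j) - t' ∈ zonotope X ∧
        (t + ctr X g + e • X j) - t ∈ zonotope X := by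
      intro e he
      have h1 : (t + ctr X g + e • X j) - t ∈ zonotope X := by
        convert hsh e he using 1
        abel
      refine ⟨(hI _ h1).2 ?_, h1⟩
      simp [hj, ctr_val]
    have e1 := (hl' _ hp).1 hct _ (hin 1 (by simp)).1
    have e2 := (hl' _ hp).1 hct _ (hin (-1) (by simp)).1
    simp only [map_sub, map_add, map_smul, smul_eq_mul] at e1 e2
    linarith
  obtain ⟨c', hc'⟩ := hg l' hvan
  have hmax := (hl' _ hp).1 hct
  -- sign of `c'`
  have hc'0 : c' < 0 := by
    by_contra hcc
    rcases (not_lt.1 hcc).eq_or_lt with h0 | h0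
    · apply hne.symm
      refine tile_sub (X := X) fun y hy => (hl' y hy).2 ?_
      simp [hc', ← h0]
    · have := hmax _ hpε
      rw [hc'] at this
      simp only [LinearMap.smul_apply, smul_eq_mul, map_sub, map_add, map_smul, ctr_val] at this
      have h3 : 0 < ε * (c' * hfun X g) := by positivity
      linarith
  -- the value of `g` at the intersection, seen from `t'`
  have hval : g t + hfun X g - g t' = - hfun X g := by
    have h1 := hmax _ (zon_neg (ctr_mem X g))
    rw [hc'] at h1
    simp only [map_neg, LinearMap.smul_apply, smul_eq_mul, map_sub, map_add, ctr_val] at h1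
    have h2 := zon_le X g (zon_neg hp)
    simp only [map_neg, map_sub, map_add, ctr_val] at h2
    nlinarith
  have hfin := transl_zero (A := {z | z ∈ zonotope X ∧ g z = hfun X g})
    ((zon_compact X).isBounded.subset fun z hz => hz.1) ⟨ctr X g, ctr_mem X g, ctr_val X g⟩
    (t' - t - (2:ℝ) • ctr X g) (by
      rintro z ⟨hz, hgz⟩
      -- reflect `z` in the facet
      have hr : (t + ((2:ℝ) • ctr X g - z)) - t ∈ zonotope X := by
        simpa using face_reflect X g hz hgz
      have hr2 : (t + ((2:ℝ) • ctr X g - z)) - t' ∈ zonotope X := by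
        refine (hI _ hr).2 ?_
        simp only [map_sub, map_add, map_smul, ctr_val, smul_eq_mul, hgz]
        ring
      refine ⟨?_, ?_⟩
      · convert zon_neg hr2 using 1
        abel
      · simp only [map_sub, map_add, map_smul, ctr_val, smul_eq_mul, hgz]
        linarith)
  have : t + (2:ℝ) • ctr X g = t' := by
    rw [sub_sub, sub_eq_zero] at hfin
    rw [← hfin]
  rw [this]
  exact ht'

/-- The rank two condition: after passing to any codimension two quotient, there are at most three
directions. -/
def PP {n d : ℕ} (X : Fin n → Fin d → ℝ) : Prop :=
  ∀ D : DP X, ∀ r s j k, r ≠ s → D.f r (X j) ≠ 0 → D.f s (X j) ≠ 0 → D.f r (X k) ≠ 0 →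
    D.f s (X k) ≠ 0 → D.f r (X j) * D.f s (X k) = D.f s (X j) * D.f r (X k)

theorem sign_opp {x y : ℝ} (h : x * y < 0) :
    ((SignType.sign x : SignType) : ℝ) + ((SignType.sign y : SignType) : ℝ) = 0 := by
  rcases mul_neg_iff.1 h with ⟨h1, h2⟩ | ⟨h1, h2⟩ <;> simp [h1, h2]

theorem DP.dual2 {n d : ℕ} {X : Fin n → Fin d → ℝ} (D : DP X) {r s : Fin d} (hrs : r ≠ s)
    (l : Module.Dual ℝ (Fin d → ℝ)) (h : ∀ t, t ≠ r → t ≠ s → l (X (D.b t)) = 0) :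
    l = l (X (D.b r)) • D.f r + l (X (D.b s)) • D.f s := by
  conv_lhs => rw [D.dual l]
  exact Fintype.sum_eq_add r s hrs fun t ht => by rw [h t ht.1 ht.2, zero_smul]

theorem PP_of_tile {n d : ℕ} {X : Fin n → Fin d → ℝ} {T : Set (Fin d → ℝ)} (hT : Tl X T) :
    PP X := by
  intro D r s j k hrs hrj hsj hrk hsk
  by_contra hdet
  obtain ⟨j0, hj0, hmax⟩ := Finset.exists_max_image
    (Finset.univ.filter fun i => D.f s (X i) ≠ 0) (fun i => D.f r (X i) / D.f s (X i))
    ⟨j, by simpa using hsj⟩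
  simp only [Finset.mem_filter, Finset.mem_univ, true_and] at hj0 hmax
  set q := D.f r (X j0) / D.f s (X j0) with hq
  set g : Module.Dual ℝ (Fin d → ℝ) := D.f r - q • D.f s with hgdef
  have hgv : ∀ v, g v = D.f r v - q * D.f s v := fun v => by simp [hgdef]
  have hg0 : g (X j0) = 0 := by
    rw [hgv, hq]
    field_simp
    ring
  have hss : D.f s (X (D.b s)) = 1 := by simp [D.h]
  have hrr : D.f r (X (D.b r)) = 1 := by simp [D.h]
  have hrs0 : D.f r (X (D.b s)) = 0 := by simp [D.h, hrs]
  have hsr0 : D.f s (X (D.b r)) = 0 := by simp [D.h, hrs.symm]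
  -- signs
  have hopp : ∀ i, D.f s (X i) ≠ 0 → g (X i) ≠ 0 → D.f s (X i) * g (X i) < 0 := by
    intro i h1 h2
    have h3 := hmax i h1
    have h4 : D.f s (X i) * g (X i) = D.f s (X i) ^ 2 * (D.f r (X i) / D.f s (X i) - q) := by
      rw [hgv]
      field_simp
    have h5 : D.f s (X i) * g (X i) ≠ 0 := mul_ne_zero h1 h2
    refine lt_of_le_of_ne ?_ h5
    rw [h4]
    exact mul_nonpos_of_nonneg_of_nonpos (sq_nonneg _) (by linarith)
  set e : Fin n → ℝ := fun i => (SignType.sign (D.f s (X i)) : ℝ) + (SignType.sign (g (X i)) : ℝ)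
    with he
  have he0 : ∀ i, D.f s (X i) ≠ 0 → g (X i) ≠ 0 → e i = 0 := fun i h1 h2 => sign_opp (hopp i h1 h2)
  have he1 : ∀ i, |e i| ≤ 1 := by
    intro i
    by_cases h1 : D.f s (X i) = 0
    · simpa [he, h1] using abs_sign_le _
    by_cases h2 : g (X i) = 0
    · simpa [he, h2] using abs_sign_le _
    rw [he0 i h1 h2]
    simp
  have hw : ctr X (D.f s) + ctr X g = ∑ i, e i • X i := by
    simp only [ctr, he, add_smul, Finset.sum_add_distrib]
  -- facets
  obtain ⟨t, ht, -⟩ := hT.1 0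
  have ht1 := facet_nb D hT (D.f s) (fun h => by simp [h] at hss) (fun l hl =>
    ⟨l (X (D.b s)), by
      conv_lhs => rw [D.dual l]
      refine Fintype.sum_eq_single s fun t hts => ?_
      rw [hl _ (by rw [D.h, if_neg hts.symm]), zero_smul]⟩) ht
  have ht2 := facet_nb D hT g (fun h => by
      have := hgv (X (D.b r))
      rw [h, hrr, hsr0] at this
      simp at this) (fun l hl => by
    have h1 := D.dual2 hrs l (fun t htr hts => hl _ (by
      rw [hgv, D.h, D.h, if_neg htr.symm, if_neg hts.symm]; ring))
    refine ⟨l (X (D.b r)), ?_⟩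
    have h2 := hl _ hg0
    rw [h1] at h2
    simp only [LinearMap.add_apply, LinearMap.smul_apply, smul_eq_mul] at h2
    have h3 : l (X (D.b s)) = - (l (X (D.b r)) * q) := by
      rw [hq]
      field_simp
      linarith
    conv_lhs => rw [h1, h3]
    rw [hgdef]
    module) ht1
  have hww := tile_int (w := ctr X (D.f s) + ctr X g) hT ht (by
      convert ht2 using 1
      module) ⟨e, he1, hw⟩ (by
    intro l hl
    rw [hw] at hl
    have hv := max_vanish X l e he1 hl
    have h1 := D.dual2 hrs l (fun t htr hts => hv _ (by
      have e1 : D.f s (X (D.b t)) = 0 := by rw [D.h, if_neg hts.symm]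
      have e2 : g (X (D.b t)) = 0 := by rw [hgv, e1, D.h, if_neg htr.symm]; ring
      simp [he, e1, e2]))
    set α := l (X (D.b r))
    set β := l (X (D.b s))
    have h2 : ∀ i, D.f s (X i) ≠ 0 → D.f r (X i) - q * D.f s (X i) ≠ 0 →
        α * D.f r (X i) + β * D.f s (X i) = 0 := by
      intro i h3 h4
      have := hv i (he0 i h3 (by rwa [hgv]))
      rw [h1] at this
      simpa using this
    have hαβ : α = 0 ∧ β = 0 := by
      by_cases hq0 : q = 0
      · have a1 := h2 j hsj (by rw [hq0]; simpa using hrj)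
        have a2 := h2 k hsk (by rw [hq0]; simpa using hrk)
        have hdet' : D.f r (X j) * D.f s (X k) - D.f s (X j) * D.f r (X k) ≠ 0 := sub_ne_zero.2 hdet
        constructor
        · refine (mul_eq_zero.1 (?_ : α * _ = 0)).resolve_right hdet'
          linear_combination D.f s (X k) * a1 - D.f s (X j) * a2
        · refine (mul_eq_zero.1 (?_ : β * _ = 0)).resolve_right hdet'
          linear_combination D.f r (X j) * a2 - D.f r (X k) * a1
      · have b0 : β = 0 := by
          have := h2 (D.b s) (by rw [hss]; exact one_ne_zero) (by rw [hss, hrs0]; simpa using hq0)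
          rw [hss, hrs0] at this
          linarith
        refine ⟨?_, b0⟩
        by_cases c1 : D.f r (X j) - q * D.f s (X j) = 0
        · have c2 : D.f r (X k) - q * D.f s (X k) ≠ 0 := by
            intro c2
            apply hdet
            linear_combination D.f s (X k) * c1 - D.f s (X j) * c2
          have := h2 k hsk c2
          rw [b0, zero_mul, add_zero] at this
          exact (mul_eq_zero.1 this).resolve_right hrk
        · have := h2 j hsj c1
          rw [b0, zero_mul, add_zero] at this
          exact (mul_eq_zero.1 this).resolve_right hrj
    rw [h1, hαβ.1, hαβ.2]
    simp)
  -- but `w ≠ 0`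
  have hpos : 0 < D.f s (∑ i, e i • X i) := by
    rw [map_sum]
    have hterm : ∀ i, 0 ≤ D.f s (e i • X i) := by
      intro i
      rw [map_smul, smul_eq_mul]
      by_cases h1 : D.f s (X i) = 0
      · simp [h1]
      by_cases h2 : g (X i) = 0
      · simp only [he, h2, sign_zero, SignType.coe_zero, add_zero, sign_mul_self]
        exact abs_nonneg _
      rw [he0 i h1 h2]
      simp
    refine Finset.sum_pos' (fun i _ => hterm i) ⟨j0, Finset.mem_univ _, ?_⟩
    rw [map_smul, smul_eq_mul]
    simp only [he, hg0, sign_zero, SignType.coe_zero, add_zero, sign_mul_self]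
    exact abs_pos.2 hj0
  rw [← hw, hww, map_zero] at hpos
  exact lt_irrefl _ hpos

/-! ### Unimodular scaling -/

open Classical in
/-- Basis exchange. -/
noncomputable def DP.pivot {n d : ℕ} {X : Fin n → Fin d → ℝ} (D : DP X) (r : Fin d) (j : Fin n)
    (hj : D.f r (X j) ≠ 0) : DP X where
  b := Function.update D.b r j
  f := fun t => if t = r then (D.f r (X j))⁻¹ • D.f r else D.f t - (D.f t (X j) / D.f r (X j)) • D.f r
  h := by
    intro t s
    by_cases hs : s = r
    · subst hs
      by_cases ht : t = s
      · subst ht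
        simp [hj]
      · simp [ht, hj]
    · rw [Function.update_of_ne hs]
      by_cases ht : t = r
      · subst ht
        simp [D.h, Ne.symm hs]
      · simp [ht, D.h, Ne.symm hs]

theorem DP.pivot_b_self {n d : ℕ} {X : Fin n → Fin d → ℝ} (D : DP X) (r : Fin d) (j : Fin n)
    (hj : D.f r (X j) ≠ 0) : (D.pivot r j hj).b r = j := by simp [DP.pivot]

theorem DP.pivot_b_ne {n d : ℕ} {X : Fin n → Fin d → ℝ} (D : DP X) (r : Fin d) (j : Fin n)
    (hj : D.f r (X j) ≠ 0) (s : Fin d) (hs : s ≠ r) : (D.pivot r j hj).b s = D.b s := by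
  simp [DP.pivot, hs]

theorem DP.pivot_f_self {n d : ℕ} {X : Fin n → Fin d → ℝ} (D : DP X) (r : Fin d) (j : Fin n)
    (hj : D.f r (X j) ≠ 0) (v : Fin d → ℝ) :
    (D.pivot r j hj).f r v = (D.f r (X j))⁻¹ * D.f r v := by simp [DP.pivot]

theorem DP.pivot_f_ne {n d : ℕ} {X : Fin n → Fin d → ℝ} (D : DP X) (r : Fin d) (j : Fin n)
    (hj : D.f r (X j) ≠ 0) (s : Fin d) (hs : s ≠ r) (v : Fin d → ℝ) :
    (D.pivot r j hj).f s v = D.f s v - D.f s (X j) / D.f r (X j) * D.f r v := by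
  simp [DP.pivot, hs]

/-- All coordinates of the vectors indexed by `S` are `0`, `1` or `-1`. -/
def DP.Uni {n d : ℕ} {X : Fin n → Fin d → ℝ} (D : DP X) (S : Set (Fin n)) : Prop :=
  ∀ j ∈ S, ∀ r, D.f r (X j) = 0 ∨ |D.f r (X j)| = 1

theorem DP.Uni.pivot {n d : ℕ} {X : Fin n → Fin d → ℝ} (hP : PP X) {D : DP X} {S : Set (Fin n)}
    (hU : D.Uni S) (r : Fin d) (j : Fin n) (hjS : j ∈ S) (hj : D.f r (X j) ≠ 0) :
    (D.pivot r j hj).Uni S := by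
  intro i hi s
  have hj1 := (hU j hjS r).resolve_left hj
  by_cases hs : s = r
  · subst hs
    rw [D.pivot_f_self]
    rcases hU i hi s with h | h
    · left; simp [h]
    · right; rw [abs_mul, abs_inv, h, hj1]; simp
  · rw [D.pivot_f_ne _ _ _ _ hs]
    by_cases h1 : D.f s (X i) = 0
    · rw [h1, zero_sub, abs_neg, neg_eq_zero]
      rcases hU i hi r with h2 | h2
      · left; simp [h2]
      rcases hU j hjS s with h3 | h3
      · left; simp [h3]
      right
      rw [abs_mul, abs_div, h2, h3, hj1]
      simp
    by_cases h2 : D.f r (X i) = 0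
    · rw [h2, mul_zero, sub_zero]; exact hU i hi s
    by_cases h3 : D.f s (X j) = 0
    · rw [h3, zero_div, zero_mul, sub_zero]; exact hU i hi s
    left
    have := hP D s r j i hs h3 hj h1 h2
    field_simp
    linarith

/-- The path lemma: coordinates of a further vector in a connected component all have the same
absolute value. -/
theorem path_lemma {n d : ℕ} {X : Fin n → Fin d → ℝ} (hP : PP X) (S : Set (Fin n)) (y : Fin n)
    (k : ℕ) : ∀ (D : DP X), D.Uni S → ∀ (ρ : ℕ → Fin d) (γ : ℕ → Fin n),
    (∀ i < k, γ i ∈ S ∧ D.f (ρ i) (X (γ i)) ≠ 0 ∧ D.f (ρ (i+1)) (X (γ i)) ≠ 0) →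
    D.f (ρ 0) (X y) ≠ 0 → D.f (ρ k) (X y) ≠ 0 → |D.f (ρ 0) (X y)| = |D.f (ρ k) (X y)| := by
  induction k using Nat.strong_induction_on with
  | _ k ih =>
  intro D hU ρ γ hp h0 hk
  rcases Nat.eq_zero_or_pos k with rfl | hkpos
  · rfl
  -- the case where two consecutive indices agree
  have hshift : ∀ i < k - 1, γ (i+1) ∈ S ∧ D.f (ρ (i+1)) (X (γ (i+1))) ≠ 0 ∧
      D.f (ρ (i+1+1)) (X (γ (i+1))) ≠ 0 := fun i hi => hp (i+1) (by omega)
  have hkk : k - 1 + 1 = k := by omega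
  by_cases h01 : ρ 0 = ρ 1
  · have := ih (k-1) (by omega) D hU (fun i => ρ (i+1)) (fun i => γ (i+1)) hshift
      (by simpa [h01] using h0) (by simpa [hkk] using hk)
    simpa [hkk, h01] using this
  obtain ⟨hS0, hr0, hr1⟩ := hp 0 hkpos
  simp only [zero_add] at hr1
  have base : D.f (ρ 1) (X y) ≠ 0 → |D.f (ρ 0) (X y)| = |D.f (ρ 1) (X y)| := by
    intro h1
    have h2 := hP D (ρ 0) (ρ 1) (γ 0) y h01 hr0 hr1 h0 h1
    have h3 := congrArg abs h2
    rw [abs_mul, abs_mul, (hU _ hS0 _).resolve_left hr0, (hU _ hS0 _).resolve_left hr1] at h3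
    linarith
  by_cases h1y : D.f (ρ 1) (X y) ≠ 0
  · have := ih (k-1) (by omega) D hU (fun i => ρ (i+1)) (fun i => γ (i+1)) hshift
      (by simpa using h1y) (by simpa [hkk] using hk)
    simp only [hkk, zero_add] at this
    rw [base h1y, this]
  push Not at h1y
  have hk2 : 2 ≤ k := by
    by_contra hlt
    have : k = 1 := by omega
    subst this
    exact hk h1y
  -- shortcut from `γ 0`
  by_cases hsc : ∃ j, 2 ≤ j ∧ j ≤ k ∧ D.f (ρ j) (X (γ 0)) ≠ 0
  · obtain ⟨j, hj2, hjk, hj⟩ := hsc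
    have := ih (k - j + 1) (by omega) D hU (fun i => if i = 0 then ρ 0 else ρ (i + j - 1))
      (fun i => if i = 0 then γ 0 else γ (i + j - 1)) (by
        intro i hi
        rcases Nat.eq_zero_or_pos i with rfl | hipos
        · simp only [if_true, zero_add, one_ne_zero, if_false]
          refine ⟨hS0, hr0, ?_⟩
          rwa [show 1 + j - 1 = j by omega]
        · have := hp (i + j - 1) (by omega)
          rw [if_neg hipos.ne', if_neg hipos.ne', if_neg (by omega),
            show i + 1 + j - 1 = i + j - 1 + 1 by omega]
          exact this) (by simpa using h0) (by
        rw [if_neg (by omega), show k - j + 1 + j - 1 = k by omega]; exact hk)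
    rwa [if_pos rfl, if_neg (by omega), show k - j + 1 + j - 1 = k by omega] at this
  push Not at hsc
  obtain ⟨hS1, hr11, hr12⟩ := hp 1 (by omega)
  simp only [Nat.reduceAdd] at hr12
  by_cases hsc2 : D.f (ρ 0) (X (γ 1)) ≠ 0
  · have := ih (k - 1) (by omega) D hU (fun i => if i = 0 then ρ 0 else ρ (i + 1))
      (fun i => γ (i + 1)) (by
        intro i hi
        rcases Nat.eq_zero_or_pos i with rfl | hipos
        · exact ⟨hS1, by simpa using hsc2, by simpa using hr12⟩
        · have := hp (i + 1) (by omega)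
          rw [if_neg hipos.ne', if_neg (by omega)]
          exact this) (by simpa using h0) (by
        rw [if_neg (by omega), hkk]; exact hk)
    rwa [if_pos rfl, if_neg (by omega), hkk] at this
  push Not at hsc2
  -- pivot
  have hne : ∀ j, 2 ≤ j → j ≤ k → ρ j ≠ ρ 1 := fun j h2 hjk h => hr1 (by rw [← h]; exact hsc j h2 hjk)
  have hsame : ∀ j, 2 ≤ j → j ≤ k → ∀ v, (D.pivot (ρ 1) (γ 0) hr1).f (ρ j) v = D.f (ρ j) v := by
    intro j h2 hjk v
    rw [D.pivot_f_ne _ _ _ _ (hne j h2 hjk), hsc j h2 hjk]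
    simp
  have hy0 : (D.pivot (ρ 1) (γ 0) hr1).f (ρ 0) (X y) = D.f (ρ 0) (X y) := by
    rw [D.pivot_f_ne _ _ _ _ h01, h1y]
    simp
  have := ih (k - 1) (by omega) (D.pivot (ρ 1) (γ 0) hr1) (hU.pivot hP _ _ hS0 hr1)
    (fun i => if i = 0 then ρ 0 else ρ (i + 1)) (fun i => γ (i + 1)) (by
        intro i hi
        rcases Nat.eq_zero_or_pos i with rfl | hipos
        · refine ⟨hS1, ?_, ?_⟩
          · rw [if_pos rfl, D.pivot_f_ne _ _ _ _ h01]
            simp only [zero_add]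
            rw [hsc2, zero_sub, neg_ne_zero]
            exact mul_ne_zero (div_ne_zero hr0 hr1) hr11
          · rw [if_neg (by omega)]
            simp only [zero_add, Nat.reduceAdd]
            rw [hsame 2 le_rfl hk2]
            exact hr12
        · have := hp (i + 1) (by omega)
          rw [if_neg hipos.ne', if_neg (by omega), hsame _ (by omega) (by omega),
            hsame _ (by omega) (by omega)]
          exact this) (by rw [if_pos rfl, hy0]; exact h0) (by
        rw [if_neg (by omega), hkk, hsame _ hk2 le_rfl]; exact hk)
  rwa [if_pos rfl, if_neg (by omega), hkk, hy0, hsame _ hk2 le_rfl] at this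

/-- Rescaling of a dual pair. -/
noncomputable def DP.scale {n d : ℕ} {X : Fin n → Fin d → ℝ} (D : DP X) (c : Fin n → ℝ)
    (hc : ∀ i, 0 < c i) : DP (fun i => c i • X i) where
  b := D.b
  f := fun r => (c (D.b r))⁻¹ • D.f r
  h := by
    intro r s
    have := (hc (D.b r)).ne'
    by_cases hrs : r = s
    · subst hrs
      simp [D.h, this]
    · simp [D.h, hrs]

theorem DP.scale_f {n d : ℕ} {X : Fin n → Fin d → ℝ} (D : DP X) (c : Fin n → ℝ)
    (hc : ∀ i, 0 < c i) (r : Fin d) (v : Fin d → ℝ) :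
    (D.scale c hc).f r v = (c (D.b r))⁻¹ * D.f r v := rfl

theorem PP.scale {n d : ℕ} {X : Fin n → Fin d → ℝ} (hP : PP X) (c : Fin n → ℝ)
    (hc : ∀ i, 0 < c i) : PP (fun i => c i • X i) := by
  intro D r s j k hrs h1 h2 h3 h4
  let D' : DP X :=
    { b := D.b
      f := fun r => c (D.b r) • D.f r
      h := fun r s => by
        have := D.h r s
        simp only [map_smul, smul_eq_mul] at this
        by_cases hrs : r = s
        · subst hrs
          simpa using this
        · rw [if_neg hrs] at this ⊢
          have h5 := (mul_eq_zero.1 this).resolve_left (hc _).ne'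
          simp [h5] }
  simp only [map_smul, smul_eq_mul] at h1 h2 h3 h4 ⊢
  have key := hP D' r s j k hrs (mul_ne_zero (hc _).ne' (right_ne_zero_of_mul h1))
    (mul_ne_zero (hc _).ne' (right_ne_zero_of_mul h2))
    (mul_ne_zero (hc _).ne' (right_ne_zero_of_mul h3))
    (mul_ne_zero (hc _).ne' (right_ne_zero_of_mul h4))
  have key' : (c (D.b r) * D.f r (X j)) * (c (D.b s) * D.f s (X k)) =
    (c (D.b s) * D.f s (X j)) * (c (D.b r) * D.f r (X k)) := key
  have hr := (hc (D.b r)).ne'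
  have hs := (hc (D.b s)).ne'
  have : D.f r (X j) * D.f s (X k) = D.f s (X j) * D.f r (X k) := by
    have h5 : (c (D.b r) * c (D.b s)) * (D.f r (X j) * D.f s (X k)) =
      (c (D.b r) * c (D.b s)) * (D.f s (X j) * D.f r (X k)) := by linarith
    exact mul_left_cancel₀ (mul_ne_zero hr hs) h5
  linear_combination c j * c k * this

/-- Two rows are adjacent if they are both in the support of some column in `S`. -/
def DP.adj {n d : ℕ} {X : Fin n → Fin d → ℝ} (D : DP X) (S : Set (Fin n)) (r s : Fin d) : Prop :=
  ∃ j ∈ S, D.f r (X j) ≠ 0 ∧ D.f s (X j) ≠ 0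

theorem DP.exists_path {n d : ℕ} {X : Fin n → Fin d → ℝ} (D : DP X) (S : Set (Fin n)) (r s : Fin d)
    (y : Fin n) (h : Relation.ReflTransGen (D.adj S) r s) :
    ∃ (k : ℕ) (ρ : ℕ → Fin d) (γ : ℕ → Fin n), ρ 0 = r ∧ ρ k = s ∧
    (∀ i < k, γ i ∈ S ∧ D.f (ρ i) (X (γ i)) ≠ 0 ∧ D.f (ρ (i+1)) (X (γ i)) ≠ 0) := by
  induction h using Relation.ReflTransGen.head_induction_on with
  | refl => exact ⟨0, fun _ => s, fun _ => y, rfl, rfl, by simp⟩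
  | @head a c h1 _ ih =>
    obtain ⟨k, ρ, γ, h0, hk, hp⟩ := ih
    obtain ⟨j, hj, ha, hc⟩ := h1
    refine ⟨k + 1, fun i => Nat.casesOn i a ρ, fun i => Nat.casesOn i j γ, rfl, hk, ?_⟩
    intro i hi
    cases i with
    | zero => exact ⟨hj, ha, by simpa [h0] using hc⟩
    | succ i => exact hp i (by omega)

theorem DP.eqv_path {n d : ℕ} {X : Fin n → Fin d → ℝ} (D : DP X) (S : Set (Fin n)) (r s : Fin d)
    (h : Relation.EqvGen (D.adj S) r s) : Relation.ReflTransGen (D.adj S) r s := by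
  induction h with
  | rel _ _ h => exact Relation.ReflTransGen.single h
  | refl _ => exact Relation.ReflTransGen.refl
  | symm _ _ _ ih =>
    have hs : Std.Symm (D.adj S) := ⟨fun a b ⟨j, hj, h1, h2⟩ => ⟨j, hj, h2, h1⟩⟩
    exact Relation.ReflTransGen.stdSymm.symm _ _ ih
  | trans _ _ _ _ _ ih1 ih2 => exact ih1.trans ih2

open Classical in
theorem scale_step {n d : ℕ} {X : Fin n → Fin d → ℝ} (hP : PP X) (D : DP X) (S : Set (Fin n))
    (hU : D.Uni S) (y : Fin n) (hyS : y ∉ S) (hyb : ∀ r, D.b r ≠ y) :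
    ∃ ν : Fin n → ℝ, (∀ i, 0 < ν i) ∧ ∀ j ∈ insert y S, ∀ r, D.f r (X j) = 0 ∨
      |D.f r (X j)| * ν j = ν (D.b r) := by
  let st := Relation.EqvGen.setoid (D.adj S)
  let μ : Quotient st → ℝ := fun q =>
    if h : ∃ r, Quotient.mk st r = q ∧ D.f r (X y) ≠ 0 then |D.f h.choose (X y)| else 1
  have hμpos : ∀ q, 0 < μ q := by
    intro q
    by_cases h : ∃ r, Quotient.mk st r = q ∧ D.f r (X y) ≠ 0
    · simp only [μ, dif_pos h]
      exact abs_pos.2 h.choose_spec.2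
    · simp only [μ, dif_neg h]
      exact one_pos
  have hμ : ∀ r, D.f r (X y) ≠ 0 → μ (Quotient.mk st r) = |D.f r (X y)| := by
    intro r hr
    have h : ∃ r', Quotient.mk st r' = Quotient.mk st r ∧ D.f r' (X y) ≠ 0 := ⟨r, rfl, hr⟩
    simp only [μ, dif_pos h]
    have h1 : Relation.EqvGen (D.adj S) h.choose r := Quotient.exact h.choose_spec.1
    obtain ⟨k, ρ, γ, h0, hk, hp⟩ := D.exists_path S _ _ y (D.eqv_path S _ _ h1)
    have := path_lemma hP S y k D hU ρ γ hp (by rw [h0]; exact h.choose_spec.2) (by rw [hk]; exact hr)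
    rw [h0, hk] at this
    exact this
  let ν : Fin n → ℝ := fun j => if j = y then 1 else
    if h : ∃ r, D.f r (X j) ≠ 0 then μ (Quotient.mk st h.choose) else 1
  have hνpos : ∀ i, 0 < ν i := by
    intro i
    simp only [ν]
    split_ifs
    · exact one_pos
    · exact hμpos _
    · exact one_pos
  have hνb : ∀ r, ν (D.b r) = μ (Quotient.mk st r) := by
    intro r
    have h : ∃ r', D.f r' (X (D.b r)) ≠ 0 := ⟨r, by simp [D.h]⟩
    simp only [ν, if_neg (hyb r), dif_pos h]
    have h1 := h.choose_spec
    have h2 : h.choose = r := by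
      by_contra hne
      rw [D.h, if_neg hne] at h1
      exact h1 rfl
    rw [h2]
  refine ⟨ν, hνpos, fun j hj r => ?_⟩
  by_cases h0 : D.f r (X j) = 0
  · exact Or.inl h0
  right
  rw [hνb]
  rcases hj with rfl | hj
  · rw [hμ r h0]
    simp [ν]
  · rw [(hU j hj r).resolve_left h0, one_mul]
    have hjy : j ≠ y := fun h => hyS (h ▸ hj)
    have h : ∃ r', D.f r' (X j) ≠ 0 := ⟨r, h0⟩
    simp only [ν, if_neg hjy, dif_pos h]
    congr 1
    exact Quotient.sound (Relation.EqvGen.rel _ _ ⟨j, hj, h.choose_spec, h0⟩)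

theorem exists_scale {n d : ℕ} {X : Fin n → Fin d → ℝ} (hP : PP X) (D : DP X) (S : Finset (Fin n)) :
    ∃ (c : Fin n → ℝ) (hc : ∀ i, 0 < c i), (D.scale c hc).Uni (S : Set (Fin n)) := by
  classical
  induction S using Finset.induction_on with
  | empty => exact ⟨fun _ => 1, fun _ => one_pos, fun j hj => by simp at hj⟩
  | insert y S hy ih =>
    obtain ⟨c, hc, hU⟩ := ih
    by_cases hyb : ∃ r, D.b r = y
    · obtain ⟨s, rfl⟩ := hyb
      refine ⟨c, hc, fun j hj r => ?_⟩
      rw [Finset.coe_insert] at hj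
      rcases hj with rfl | hj
      · have := (D.scale c hc).h r s
        change (D.scale c hc).f r (c (D.b s) • X (D.b s)) = _ at this
        rw [this]
        split_ifs <;> simp
      · exact hU j hj r
    · push Not at hyb
      obtain ⟨ν, hν, h⟩ := scale_step (hP.scale c hc) (D.scale c hc) S hU y (by simpa using hy) hyb
      refine ⟨fun i => ν i * c i, fun i => mul_pos (hν i) (hc i), fun j hj r => ?_⟩
      rw [Finset.coe_insert] at hj
      have h1 := h j hj r
      have hb : (D.scale c hc).b r = D.b r := rfl
      rw [hb] at h1
      simp only [D.scale_f, map_smul, smul_eq_mul] at h1 ⊢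
      have h2 := (hν (D.b r))
      have h3 := (hc (D.b r))
      rcases h1 with h1 | h1
      · left
        have : (ν (D.b r) * c (D.b r))⁻¹ * (ν j * c j * D.f r (X j)) =
          (ν (D.b r))⁻¹ * ν j * ((c (D.b r))⁻¹ * (c j * D.f r (X j))) := by
          field_simp
        rw [this, h1, mul_zero]
      · right
        have : (ν (D.b r) * c (D.b r))⁻¹ * (ν j * c j * D.f r (X j)) =
          (ν (D.b r))⁻¹ * (((c (D.b r))⁻¹ * (c j * D.f r (X j))) * ν j) := by
          field_simp
        rw [this, abs_mul, abs_mul, abs_of_pos (hν j), h1, abs_of_pos (inv_pos.2 h2)]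
        field_simp

/-! ### Minimal supports -/

/-- Functionals of minimal support. -/
def MinS {n d : ℕ} (X : Fin n → Fin d → ℝ) (f : Module.Dual ℝ (Fin d → ℝ)) : Prop :=
  f ≠ 0 ∧ ∀ g : Module.Dual ℝ (Fin d → ℝ), g ≠ 0 → ¬ ({i | g (X i) ≠ 0} ⊂ {i | f (X i) ≠ 0})

/-- A functional of minimal support is a multiple of one with entries `0, 1, -1`. -/
theorem min_uni {n d : ℕ} {X : Fin n → Fin d → ℝ} (hP : PP X) {f : Module.Dual ℝ (Fin d → ℝ)}
    (hf : MinS X f) (k : ℕ) : ∀ D : DP X, D.Uni Set.univ →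
    (Finset.univ.filter fun r => f (X (D.b r)) ≠ 0).card = k →
    ∃ κ : ℝ, 0 < κ ∧ ∃ g : Module.Dual ℝ (Fin d → ℝ), f = κ • g ∧
      ∀ i, g (X i) = 0 ∨ |g (X i)| = 1 := by
  classical
  induction k using Nat.strong_induction_on with
  | _ k ih =>
  intro D hU hk
  have hex : ∃ r, f (X (D.b r)) ≠ 0 := by
    by_contra hno
    push Not at hno
    apply hf.1
    rw [D.dual f]
    exact Finset.sum_eq_zero fun r _ => by rw [hno r, zero_smul]
  obtain ⟨r, hr⟩ := hex
  by_cases hj : ∃ j, f (X j) = 0 ∧ D.f r (X j) ≠ 0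
  · obtain ⟨j, hj0, hj⟩ := hj
    refine ih _ ?_ (D.pivot r j hj) (hU.pivot hP r j trivial hj) rfl
    rw [← hk]
    refine Finset.card_lt_card ?_
    rw [Finset.ssubset_iff_of_subset]
    · refine ⟨r, by simpa using hr, ?_⟩
      simp [D.pivot_b_self, hj0]
    · intro s hs
      simp only [Finset.mem_filter, Finset.mem_univ, true_and] at hs ⊢
      by_cases hsr : s = r
      · rw [hsr]; exact hr
      · rwa [D.pivot_b_ne _ _ _ _ hsr] at hs
  · push Not at hj
    have honly : ∀ s, s ≠ r → f (X (D.b s)) = 0 := by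
      intro s hs
      by_contra hne
      refine hf.2 (D.f r) ?_ ?_
      · intro h
        have := D.h r r
        simp [h] at this
      · rw [Set.ssubset_iff_of_subset]
        · exact ⟨D.b s, hne, by simp [D.h, hs.symm]⟩
        · intro i hi h0
          exact hi (hj i h0)
    have hfe : f = f (X (D.b r)) • D.f r := by
      conv_lhs => rw [D.dual f]
      exact Fintype.sum_eq_single r fun s hs => by rw [honly s hs, zero_smul]
    rcases lt_or_gt_of_ne hr with h | h
    · refine ⟨- f (X (D.b r)), by linarith, - D.f r, ?_, fun i => ?_⟩
      · rw [smul_neg, neg_smul, neg_neg]; exact hfe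
      · simpa using hU i trivial r
    · exact ⟨_, h, D.f r, hfe, fun i => hU i trivial r⟩

theorem abs_split {a b : ℝ} (h0 : a + b = 0 → a = 0) (h1 : 0 ≤ a * (a + b)) (h2 : 0 ≤ b * (a + b)) :
    |a + b| = |a| + |b| := by
  rcases lt_trichotomy (a + b) 0 with h | h | h
  · have ha : a ≤ 0 := by
      by_contra hh
      nlinarith [mul_neg_of_pos_of_neg (not_le.1 hh) h]
    have hb : b ≤ 0 := by
      by_contra hh
      nlinarith [mul_neg_of_pos_of_neg (not_le.1 hh) h]
    rw [abs_of_neg h, abs_of_nonpos ha, abs_of_nonpos hb]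
    ring
  · have ha := h0 h
    subst ha
    simp
  · have ha : 0 ≤ a := nonneg_of_mul_nonneg_left h1 h
    have hb : 0 ≤ b := nonneg_of_mul_nonneg_left h2 h
    rw [abs_of_pos h, abs_of_nonneg ha, abs_of_nonneg hb]

theorem conf_one {n d : ℕ} {X : Fin n → Fin d → ℝ} {f g : Module.Dual ℝ (Fin d → ℝ)}
    (hs : ∀ i, f (X i) = 0 → g (X i) = 0) (hpos : ∃ i, 0 < g (X i) * f (X i)) :
    ∃ α : ℝ, 0 < α ∧ (∀ i, 0 ≤ (f - α • g) (X i) * f (X i)) ∧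
      {i | (f - α • g) (X i) ≠ 0} ⊂ {i | f (X i) ≠ 0} := by
  classical
  obtain ⟨i0, hi0⟩ := hpos
  obtain ⟨j, hj, hmin⟩ := Finset.exists_min_image
    (Finset.univ.filter fun i => 0 < g (X i) * f (X i)) (fun i => f (X i) / g (X i))
    ⟨i0, by simpa using hi0⟩
  simp only [Finset.mem_filter, Finset.mem_univ, true_and] at hj hmin
  have hgj : g (X j) ≠ 0 := left_ne_zero_of_mul hj.ne'
  have hα : 0 < f (X j) / g (X j) := by
    rcases mul_pos_iff.1 hj with ⟨h1, h2⟩ | ⟨h1, h2⟩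
    · exact div_pos h2 h1
    · exact div_pos_of_neg_of_neg h2 h1
  refine ⟨_, hα, fun i => ?_, ?_⟩
  · simp only [LinearMap.sub_apply, LinearMap.smul_apply, smul_eq_mul]
    by_cases h : 0 < g (X i) * f (X i)
    · have h1 := hmin i h
      have h2 : g (X i) ≠ 0 := left_ne_zero_of_mul h.ne'
      have h3 : (f (X i) - f (X j) / g (X j) * g (X i)) * f (X i) =
          (f (X i) / g (X i) - f (X j) / g (X j)) * (g (X i) * f (X i)) := by
        rw [sub_mul, sub_mul]
        congr 1
        · field_simp
        · ring
      rw [h3]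
      exact mul_nonneg (by linarith) h.le
    · nlinarith [mul_nonneg hα.le (neg_nonneg.2 (not_lt.1 h)), sq_nonneg (f (X i))]
  · rw [Set.ssubset_iff_of_subset]
    · refine ⟨j, right_ne_zero_of_mul hj.ne', ?_⟩
      simp [hgj]
    · intro i hi h0
      apply hi
      simp [h0, hs i h0]

/-- A functional which does not have minimal support is a conformal sum of two functionals of
smaller support. -/
theorem conf_split {n d : ℕ} {X : Fin n → Fin d → ℝ} (D : DP X) {f : Module.Dual ℝ (Fin d → ℝ)}
    (hf0 : f ≠ 0) (hf : ¬ MinS X f) : ∃ f₁ f₂ : Module.Dual ℝ (Fin d → ℝ), f = f₁ + f₂ ∧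
      {i | f₁ (X i) ≠ 0} ⊂ {i | f (X i) ≠ 0} ∧ {i | f₂ (X i) ≠ 0} ⊂ {i | f (X i) ≠ 0} ∧
      ∀ i, |f (X i)| = |f₁ (X i)| + |f₂ (X i)| := by
  have caseA : ∀ g : Module.Dual ℝ (Fin d → ℝ), {i | g (X i) ≠ 0} ⊂ {i | f (X i) ≠ 0} →
      (∃ i, 0 < g (X i) * f (X i)) → (∀ i, 0 ≤ g (X i) * f (X i)) →
      ∃ f₁ f₂ : Module.Dual ℝ (Fin d → ℝ), f = f₁ + f₂ ∧
      {i | f₁ (X i) ≠ 0} ⊂ {i | f (X i) ≠ 0} ∧ {i | f₂ (X i) ≠ 0} ⊂ {i | f (X i) ≠ 0} ∧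
      ∀ i, |f (X i)| = |f₁ (X i)| + |f₂ (X i)| := by
    intro g hg hpos hnn
    have hs : ∀ i, f (X i) = 0 → g (X i) = 0 := fun i h => by
      by_contra h'
      exact hg.1 h' h
    obtain ⟨α, hα, h1, h2⟩ := conf_one hs hpos
    have hfe : f = α • g + (f - α • g) := by abel
    refine ⟨α • g, f - α • g, hfe, ?_, h2, fun i => ?_⟩
    · convert hg using 3
      simp [hα.ne']
    · have e : f (X i) = (α • g) (X i) + (f - α • g) (X i) := by simp
      have h3 := h1 i
      rw [e]
      refine abs_split ?_ ?_ ?_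
      · rw [← e]
        intro h0
        simp [hs i h0]
      · rw [← e]
        simp only [LinearMap.smul_apply, smul_eq_mul]
        rw [mul_assoc]
        exact mul_nonneg hα.le (hnn i)
      · rw [← e]
        exact h3
  have : ∃ g : Module.Dual ℝ (Fin d → ℝ), g ≠ 0 ∧ {i | g (X i) ≠ 0} ⊂ {i | f (X i) ≠ 0} := by
    by_contra hno
    push Not at hno
    exact hf ⟨hf0, hno⟩
  obtain ⟨g, hg0, hg⟩ := this
  have hs : ∀ i, f (X i) = 0 → g (X i) = 0 := fun i h => by
    by_contra h'
    exact hg.1 h' h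
  by_cases hpos : ∃ i, 0 < g (X i) * f (X i)
  · by_cases hneg : ∃ i, g (X i) * f (X i) < 0
    · obtain ⟨α, hα, a1, a2⟩ := conf_one hs hpos
      obtain ⟨β, hβ, b1, b2⟩ := conf_one (X := X) (f := f) (g := -g) (fun i h => by simp [hs i h])
        (by obtain ⟨i, hi⟩ := hneg; exact ⟨i, by simpa using hi⟩)
      have hab : 0 < α + β := by linarith
      have hfe : f = (β / (α + β)) • (f - α • g) + (α / (α + β)) • (f - β • (-g)) := by
        refine LinearMap.ext fun v => ?_
        simp only [LinearMap.add_apply, LinearMap.smul_apply, LinearMap.sub_apply,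
          LinearMap.neg_apply, smul_eq_mul]
        field_simp
        ring
      refine ⟨_, _, hfe, ?_, ?_, fun i => ?_⟩
      · convert a2 using 3
        simp only [LinearMap.smul_apply (β / (α + β)), smul_eq_mul, ne_eq, mul_eq_zero,
          (div_pos hβ hab).ne', false_or]
      · convert b2 using 3
        simp only [LinearMap.smul_apply (α / (α + β)), smul_eq_mul, ne_eq, mul_eq_zero,
          (div_pos hα hab).ne', false_or]
      · have e : f (X i) = ((β / (α + β)) • (f - α • g)) (X i) +
            ((α / (α + β)) • (f - β • (-g))) (X i) := by
          conv_lhs => rw [hfe]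
          rfl
        rw [e]
        refine abs_split ?_ ?_ ?_
        · rw [← e]
          intro h0
          simp [hs i h0, h0]
        · rw [← e, LinearMap.smul_apply (β / (α + β)), smul_eq_mul, mul_assoc]
          exact mul_nonneg (div_pos hβ hab).le (a1 i)
        · rw [← e, LinearMap.smul_apply (α / (α + β)), smul_eq_mul, mul_assoc]
          exact mul_nonneg (div_pos hα hab).le (b1 i)
    · push Not at hneg
      exact caseA g hg hpos hneg
  · push Not at hpos
    refine caseA (-g) (by simpa using hg) ?_ (fun i => by simpa using hpos i)
    have : ∃ r, g (X (D.b r)) ≠ 0 := by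
      by_contra hno
      push Not at hno
      apply hg0
      rw [D.dual g]
      exact Finset.sum_eq_zero fun r _ => by rw [hno r, zero_smul]
    obtain ⟨r, hr⟩ := this
    refine ⟨D.b r, ?_⟩
    have h1 : g (X (D.b r)) * f (X (D.b r)) ≠ 0 := mul_ne_zero hr fun h => hr (hs _ h)
    have h2 := lt_of_le_of_ne (hpos (D.b r)) h1
    simpa using h2

theorem conf_ind {n d : ℕ} {X : Fin n → Fin d → ℝ} (D : DP X)
    (Q : Module.Dual ℝ (Fin d → ℝ) → Prop) (h0 : Q 0) (hm : ∀ f, MinS X f → Q f)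
    (ha : ∀ f₁ f₂, (∀ i, |(f₁ + f₂) (X i)| = |f₁ (X i)| + |f₂ (X i)|) → Q f₁ → Q f₂ → Q (f₁ + f₂))
    (f : Module.Dual ℝ (Fin d → ℝ)) : Q f := by
  induction hk : {i | f (X i) ≠ 0}.ncard using Nat.strong_induction_on generalizing f with
  | _ k ih =>
  by_cases hf0 : f = 0
  · rw [hf0]; exact h0
  by_cases hf : MinS X f
  · exact hm f hf
  obtain ⟨f₁, f₂, hfe, h1, h2, habs⟩ := conf_split D hf0 hf
  have q1 := ih _ (by rw [← hk]; exact Set.ncard_lt_ncard h1) f₁ rfl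
  have q2 := ih _ (by rw [← hk]; exact Set.ncard_lt_ncard h2) f₂ rfl
  rw [hfe]
  refine ha f₁ f₂ ?_ q1 q2
  rw [← hfe]
  exact habs

theorem exists_minS {n d : ℕ} (X : Fin n → Fin d → ℝ)
    (f : Module.Dual ℝ (Fin d → ℝ)) (hf0 : f ≠ 0) :
    ∃ g, MinS X g ∧ {i | g (X i) ≠ 0} ⊆ {i | f (X i) ≠ 0} := by
  induction hk : {i | f (X i) ≠ 0}.ncard using Nat.strong_induction_on generalizing f with
  | _ k ih =>
  by_cases hf : MinS X f
  · exact ⟨f, hf, subset_rfl⟩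
  have : ∃ g : Module.Dual ℝ (Fin d → ℝ), g ≠ 0 ∧ {i | g (X i) ≠ 0} ⊂ {i | f (X i) ≠ 0} := by
    by_contra hno
    push Not at hno
    exact hf ⟨hf0, hno⟩
  obtain ⟨g, hg0, hg⟩ := this
  obtain ⟨g', h1, h2⟩ := ih _ (by rw [← hk]; exact Set.ncard_lt_ncard hg) g hg0 rfl
  exact ⟨g', h1, h2.trans hg.1⟩

/-! ### Cocircuits -/

theorem sgnR_ne {t : ℝ} : sgnR t ≠ 0 ↔ t ≠ 0 := by
  unfold sgnR
  split_ifs with h1 h2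
  · simp [h1.ne']
  · simp [h2.ne]
  · simp; linarith

theorem dual_ne {n d : ℕ} {X : Fin n → Fin d → ℝ} (D : DP X) {f : Module.Dual ℝ (Fin d → ℝ)}
    (hf : f ≠ 0) : ∃ i, f (X i) ≠ 0 := by
  by_contra hno
  push Not at hno
  apply hf
  rw [D.dual f]
  exact Finset.sum_eq_zero fun r _ => by rw [hno, zero_smul]

theorem supp_sgn {n d : ℕ} (X : Fin n → Fin d → ℝ) (f : Module.Dual ℝ (Fin d → ℝ)) :
    supp (fun i => sgnR (f (X i))) = {i | f (X i) ≠ 0} := by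
  ext i
  exact sgnR_ne

theorem cocircuit_iff {n d : ℕ} {X : Fin n → Fin d → ℝ} (D : DP X) (u : Fin n → ℤ) :
    IsCocircuit X u ↔ ∃ f, MinS X f ∧ u = fun i => sgnR (f (X i)) := by
  constructor
  · rintro ⟨⟨f, hf⟩, hu0, hmin⟩
    have hu : u = fun i => sgnR (f (X i)) := funext hf
    refine ⟨f, ⟨?_, fun g hg hlt => ?_⟩, hu⟩
    · rintro rfl
      apply hu0
      rw [hu]
      funext i
      simp [sgnR]
    · refine hmin (fun i => sgnR (g (X i))) ⟨g, fun _ => rfl⟩ ?_ ?_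
      · obtain ⟨i, hi⟩ := dual_ne D hg
        intro h
        exact sgnR_ne.2 hi (congrFun h i)
      · rw [hu, supp_sgn, supp_sgn]
        exact hlt
  · rintro ⟨f, ⟨hf0, hmin⟩, rfl⟩
    refine ⟨⟨f, fun _ => rfl⟩, ?_, ?_⟩
    · obtain ⟨i, hi⟩ := dual_ne D hf0
      intro h
      exact sgnR_ne.2 hi (congrFun h i)
    · rintro t ⟨g, hg⟩ ht0 hlt
      have ht : t = fun i => sgnR (g (X i)) := funext hg
      refine hmin g ?_ ?_
      · rintro rfl
        apply ht0
        rw [ht]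
        funext i
        simp [sgnR]
      · rw [ht, supp_sgn, supp_sgn] at hlt
        exact hlt

/-- The evaluation map. -/
noncomputable def evalMap {n d : ℕ} (Y : Fin n → Fin d → ℝ) :
    Module.Dual ℝ (Fin d → ℝ) →ₗ[ℝ] (Fin n → ℝ) where
  toFun f := fun i => f (Y i)
  map_add' _ _ := rfl
  map_smul' _ _ := rfl

/-- The key consequence of the tiling property: the configuration is unimodular after scaling. -/
theorem key_scale {n d : ℕ} {X : Fin n → Fin d → ℝ} (hP : PP X) (D : DP X) :
    ∃ c : Fin n → ℝ, (∀ i, 0 < c i) ∧ ∀ f, MinS X f → ∃ κ : ℝ, 0 < κ ∧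
      ∃ g : Module.Dual ℝ (Fin d → ℝ), f = κ • g ∧ ∀ i, g (c i • X i) = (sgnR (f (X i)) : ℝ) := by
  obtain ⟨c, hc, hU⟩ := exists_scale hP D Finset.univ
  rw [Finset.coe_univ] at hU
  refine ⟨c, hc, fun f hf => ?_⟩
  have hsup : ∀ f : Module.Dual ℝ (Fin d → ℝ),
      {i | f (c i • X i) ≠ 0} = {i | f (X i) ≠ 0} := by
    intro f
    ext i
    simp [(hc i).ne']
  have hf' : MinS (fun i => c i • X i) f := by
    refine ⟨hf.1, fun g hg => ?_⟩
    rw [hsup, hsup]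
    exact hf.2 g hg
  obtain ⟨κ, hκ, g, hfg, hg⟩ := min_uni (hP.scale c hc) hf' _ (D.scale c hc) hU rfl
  refine ⟨κ, hκ, g, hfg, fun i => ?_⟩
  have h1 : f (X i) = κ * g (X i) := by rw [hfg]; rfl
  have h2 := hg i
  simp only [map_smul, smul_eq_mul] at h2 ⊢
  have hci := hc i
  unfold sgnR
  rcases lt_trichotomy (g (X i)) 0 with h | h | h
  · have h3 : f (X i) < 0 := by rw [h1]; exact mul_neg_of_pos_of_neg hκ h
    have h4 : c i * g (X i) < 0 := mul_neg_of_pos_of_neg hci h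
    rw [if_neg (by linarith), if_pos h3]
    have := h2.resolve_left h4.ne
    rw [abs_of_neg h4] at this
    push_cast
    linarith
  · have h3 : f (X i) = 0 := by rw [h1, h, mul_zero]
    simp [h, h3]
  · have h3 : 0 < f (X i) := by rw [h1]; positivity
    have h4 : 0 < c i * g (X i) := by positivity
    rw [if_pos h3]
    have := h2.resolve_left h4.ne'
    rw [abs_of_pos h4] at this
    push_cast
    linarith

/-- If the zonotope of a configuration `X` of nonzero vectors spanning
`ℝ^d` (`d ≥ 2`) tiles space face-to-face by translations, then the lattice `L`
generated by the cocircuits of `X` is zonotopal of rank `d`, and for some weighted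
inner product the Dirichlet-Voronoi polytope of `L` is affinely equivalent to
`Z(X)`. -/
theorem tiling_cocircuitLattice_zonotopal_DV_affEquiv {n d : ℕ} (hd : 2 ≤ d)
    (X : Fin n → Fin d → ℝ) (hX0 : ∀ i, X i ≠ 0)
    (hX : Submodule.span ℝ (Set.range X) = ⊤)
    (htile : TilesFaceToFace (zonotope X)) :
    IsZonotopal (cocircuitLattice X) ∧
    Module.finrank ℝ (latticeSpan (cocircuitLattice X)) = d ∧
    ∃ lam : Fin n → ℝ, (∀ i, 0 < lam i) ∧
      ∃ T : (Fin n → ℝ) →ₗ[ℝ] (Fin d → ℝ),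
        Set.BijOn T (latticeSpan (cocircuitLattice X) : Set (Fin n → ℝ))
          Set.univ ∧
        T '' DV (cocircuitLattice X) lam = zonotope X := by
  obtain ⟨T₀, hT⟩ := tl_of_tiles X htile
  have hP : PP X := PP_of_tile hT
  obtain ⟨D⟩ := DP.exists X hX
  obtain ⟨c, hc, hkey⟩ := key_scale hP D
  set Y : Fin n → Fin d → ℝ := fun i => c i • X i with hY
  set L := cocircuitLattice X with hL
  -- every minimal functional gives a lattice vector
  have hminL : ∀ f, MinS X f → (fun i => sgnR (f (X i))) ∈ L := fun f hf =>
    AddSubgroup.subset_closure ((cocircuit_iff D _).2 ⟨f, hf, rfl⟩)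
  -- lattice vectors come from functionals
  have hLfun : ∀ v ∈ L, ∃ f, icast v = evalMap Y f := by
    intro v hv
    induction hv using AddSubgroup.closure_induction with
    | mem u hu =>
      obtain ⟨f, hf, rfl⟩ := (cocircuit_iff D _).1 hu
      obtain ⟨κ, hκ, g, hfg, hg⟩ := hkey f hf
      exact ⟨g, funext fun i => (hg i).symm⟩
    | zero => exact ⟨0, funext fun i => by simp [icast, evalMap]⟩
    | add u v _ _ hu hv =>
      obtain ⟨f, hf⟩ := hu
      obtain ⟨g, hg⟩ := hv
      refine ⟨f + g, ?_⟩
      rw [map_add, ← hf, ← hg]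
      funext i
      simp [icast]
    | neg u _ hu =>
      obtain ⟨f, hf⟩ := hu
      refine ⟨-f, ?_⟩
      rw [map_neg, ← hf]
      funext i
      simp [icast]
  have hsupY : ∀ (f : Module.Dual ℝ (Fin d → ℝ)) i, f (Y i) = c i * f (X i) := fun f i => by
    simp [hY]
  have hsuppv : ∀ (v : Fin n → ℤ) f, icast v = evalMap Y f → supp v = {i | f (X i) ≠ 0} := by
    intro v f h
    ext i
    have h1 : (v i : ℝ) = c i * f (X i) := by
      rw [← hsupY]
      exact congrFun h i
    change v i ≠ 0 ↔ f (X i) ≠ 0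
    rw [← Int.cast_ne_zero (α := ℝ), h1]
    simp [(hc i).ne']
  have hfne : ∀ (v : Fin n → ℤ) f, icast v = evalMap Y f → v ≠ 0 → f ≠ 0 := by
    rintro v f h hv rfl
    apply hv
    funext i
    have : (v i : ℝ) = 0 := by
      have := congrFun h i
      simpa [icast, evalMap] using this
    exact_mod_cast this
  have hspan : latticeSpan L = LinearMap.range (evalMap Y) := by
    apply le_antisymm
    · refine Submodule.span_le.2 ?_
      rintro _ ⟨v, hv, rfl⟩
      obtain ⟨f, hf⟩ := hLfun v hv
      exact ⟨f, hf.symm⟩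
    · rintro _ ⟨f, rfl⟩
      refine conf_ind D (fun f => evalMap Y f ∈ latticeSpan L) ?_ ?_ ?_ f
      · rw [map_zero]; exact Submodule.zero_mem _
      · intro f hf
        obtain ⟨κ, hκ, g, hfg, hg⟩ := hkey f hf
        rw [hfg, map_smul]
        refine Submodule.smul_mem _ _ (Submodule.subset_span ⟨_, hminL f hf, ?_⟩)
        exact funext fun i => (hg i).symm
      · intro f₁ f₂ _ h1 h2
        rw [map_add]
        exact Submodule.add_mem _ h1 h2
  have hinj : Function.Injective (evalMap Y) := by
    rw [injective_iff_map_eq_zero]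
    intro f hf
    by_contra hne
    obtain ⟨i, hi⟩ := dual_ne D hne
    have h1 : f (Y i) = 0 := congrFun hf i
    rw [hsupY] at h1
    exact hi ((mul_eq_zero.1 h1).resolve_left (hc i).ne')
  have hfr : Module.finrank ℝ (latticeSpan L) = d := by
    rw [hspan, LinearMap.finrank_range_of_inj hinj, Subspace.dual_finrank_eq,
      Module.finrank_fin_fun]
  refine ⟨?_, hfr, ?_⟩
  · -- zonotopal
    intro v hv hv0
    obtain ⟨f, hf⟩ := hLfun v hv
    obtain ⟨g, hg, hgs⟩ := exists_minS X f (hfne v f hf hv0)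
    obtain ⟨hcov, hu0, humin⟩ := (cocircuit_iff D _).2 ⟨g, hg, rfl⟩
    refine ⟨fun i => sgnR (g (X i)), ⟨hminL g hg, hu0, fun i => ?_, fun w hw hw0 hlt => ?_⟩, ?_⟩
    · simp only [sgnR]
      split_ifs <;> simp
    · obtain ⟨f', hf'⟩ := hLfun w hw
      rw [hsuppv w f' hf', supp_sgn] at hlt
      exact hg.2 f' (hfne w f' hf' hw0) hlt
    · rw [hsuppv v f hf, supp_sgn]
      exact hgs
  · refine ⟨fun i => 2 / c i, fun i => div_pos two_pos (hc i),
      (2:ℝ) • Fintype.linearCombination ℝ X, ?_⟩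
    set lam : Fin n → ℝ := fun i => 2 / c i with hlam
    set T : (Fin n → ℝ) →ₗ[ℝ] (Fin d → ℝ) := (2:ℝ) • Fintype.linearCombination ℝ X with hTdef
    have hTw : ∀ (x : Fin n → ℝ) (f : Module.Dual ℝ (Fin d → ℝ)),
        f (T x) = wip lam x (evalMap Y f) := by
      intro x f
      simp only [hTdef, LinearMap.smul_apply, Fintype.linearCombination_apply, map_smul, map_sum,
        smul_eq_mul, wip, Finset.mul_sum]
      refine Finset.sum_congr rfl fun i _ => ?_
      have : evalMap Y f i = c i * f (X i) := hsupY f i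
      rw [this, hlam]
      have := (hc i).ne'
      field_simp
    have hTinj : ∀ x ∈ latticeSpan L, T x = 0 → x = 0 := by
      intro x hx hx0
      rw [hspan] at hx
      obtain ⟨f, rfl⟩ := hx
      have h1 := hTw (evalMap Y f) f
      rw [hx0, map_zero, wip] at h1
      have h2 := (Finset.sum_eq_zero_iff_of_nonneg (fun i _ => by
        have : 0 < lam i := div_pos two_pos (hc i)
        rw [mul_assoc]
        exact mul_nonneg this.le (mul_self_nonneg _))).1 h1.symm
      funext i
      have h3 := h2 i (Finset.mem_univ _)
      have : lam i ≠ 0 := (div_pos two_pos (hc i)).ne'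
      rw [mul_assoc] at h3
      exact mul_self_eq_zero.1 ((mul_eq_zero.1 h3).resolve_left this)
    have hbij : Set.BijOn T (latticeSpan L : Set (Fin n → ℝ)) Set.univ := by
      have hi : Function.Injective (T.domRestrict (latticeSpan L)) := by
        rw [injective_iff_map_eq_zero]
        rintro ⟨x, hx⟩ h
        exact Subtype.ext (hTinj x hx h)
      have hsj : Function.Surjective (T.domRestrict (latticeSpan L)) :=
        (LinearMap.injective_iff_surjective_of_finrank_eq_finrank
          (by rw [hfr, Module.finrank_fin_fun])).1 hi
      refine ⟨fun _ _ => trivial, fun x hx y hy h => ?_, fun z _ => ?_⟩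
      · exact congrArg Subtype.val (@hi ⟨x, hx⟩ ⟨y, hy⟩ h)
      · obtain ⟨⟨x, hx⟩, h⟩ := hsj z
        exact ⟨x, hx, h⟩
    refine ⟨hbij, ?_⟩
    have hhf : ∀ f : Module.Dual ℝ (Fin d → ℝ), hfun X f = ∑ i, |f (Y i)| / c i := by
      intro f
      refine Finset.sum_congr rfl fun i _ => ?_
      have := hc i
      rw [hsupY, abs_mul, abs_of_pos this]
      field_simp
    have hww : ∀ v : Fin n → ℤ, wip lam (icast v) (icast v) / 2 = ∑ i, (v i : ℝ) ^ 2 / c i := by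
      intro v
      rw [wip, Finset.sum_div]
      refine Finset.sum_congr rfl fun i _ => ?_
      have := (hc i).ne'
      simp only [hlam, icast]
      field_simp
    apply Set.Subset.antisymm
    · rintro _ ⟨x, ⟨hx, hv⟩, rfl⟩
      refine zon_of_le X _ fun f => ?_
      refine conf_ind D (fun f => f (T x) ≤ hfun X f) ?_ ?_ ?_ f
      · simp [hfun]
      · intro f hf
        obtain ⟨κ, hκ, g, hfg, hg⟩ := hkey f hf
        have hgi : evalMap Y g = icast (fun i => sgnR (f (X i))) := funext hg
        have h1 := hv _ (hminL f hf)
        rw [← hgi, ← hTw, hgi, hww] at h1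
        have h2 : hfun X f = κ * hfun X g := by
          rw [hfun, hfun, Finset.mul_sum]
          refine Finset.sum_congr rfl fun i _ => ?_
          rw [hfg, LinearMap.smul_apply, smul_eq_mul, abs_mul, abs_of_pos hκ]
        rw [h2]
        have h3 : f (T x) = κ * g (T x) := by rw [hfg]; rfl
        rw [h3]
        refine mul_le_mul_of_nonneg_left (h1.trans (le_of_eq ?_)) hκ.le
        rw [hhf]
        refine Finset.sum_congr rfl fun i _ => ?_
        have : g (Y i) = _ := hg i
        rw [this]
        congr 1
        simp only [sgnR]
        split_ifs <;> simp
      · intro f₁ f₂ habs h1 h2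
        have : hfun X (f₁ + f₂) = hfun X f₁ + hfun X f₂ := by
          simp only [hfun]
          rw [← Finset.sum_add_distrib]
          exact Finset.sum_congr rfl fun i _ => habs i
        rw [this, LinearMap.add_apply]
        exact add_le_add h1 h2
    · intro z hz
      obtain ⟨x, hx, rfl⟩ := hbij.surjOn (Set.mem_univ z)
      refine ⟨x, ⟨hx, fun v hv => ?_⟩, rfl⟩
      obtain ⟨f, hf⟩ := hLfun v hv
      rw [hww, hf, ← hTw]
      refine (zon_le X f hz).trans ?_
      rw [hhf]
      refine Finset.sum_le_sum fun i _ => ?_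
      have : f (Y i) = v i := (congrFun hf i).symm
      rw [this]
      refine div_le_div_of_nonneg_right ?_ (hc i).le
      rw [← sq_abs]
      rcases eq_or_ne (v i) 0 with h | h
      · simp [h]
      · have h1 : (1:ℝ) ≤ |(v i : ℝ)| := by exact_mod_cast Int.one_le_abs h
        nlinarith
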